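/- Let (Δ_k)_{k≥0} be positive reals with Δ_k → +∞, and for each k let g_k ∈ D^ω(𝕋, Δ_k) with rotation number ρ(g_k) = α for all k, where α is irrational. Let G_k be the induced map on the annulus A_{Δ_k} = {e^{2πiz} : z ∈ B_{Δ_k}} ⊂ ℂ∖{0}, characterized by G_k(e^{2πiz}) = e^{2πi g_k(z)} for z ∈ B_{Δ_k}. Then: (1) G_k converges to the rigid rotation w ↦ e^{2πiα}·w uniformly on every compact subset of ℂ∖{0} (i.e. for every compact S ⊂ ℂ∖{0}, sup_{w∈S} |G_k(w) − e^{2πiα}w| → 0, the supremum being taken for k large enough that S ⊂ A_{Δ_k}); and (2) sup_{x∈ℝ} |g_k″(x)/g_k′(x)| → 0 as k → ∞. -/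

import Mathlib

open Filter Topology
open Complex Metric Set MeasureTheory

lemma aux_max (q : ℂ → ℂ) (hq : DifferentiableOn ℂ q (ball 0 1))
    (hinj : InjOn (fun z => z⁻¹ + q z) (ball 0 1 \ {0})) (s M : ℝ) (hs : 0 < s)
    (hM : ∀ z : ℂ, ‖z‖ = s → ‖z⁻¹ + q z‖ ≤ M) (z₁ : ℂ) (h1 : s < ‖z₁‖) (h2 : ‖z₁‖ < 1) :
    ‖z₁⁻¹ + q z₁‖ ≤ M := by
  by_contra! hlt
  set v := z₁⁻¹ + q z₁ with hv
  have hM0 : 0 ≤ M := (norm_nonneg _).trans (hM s (by simp [abs_of_pos hs]))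
  have hv0 : v ≠ 0 := by
    intro h; rw [h, norm_zero] at hlt; linarith
  have hz1 : z₁ ≠ 0 := by rintro rfl; simp at h1; linarith
  have hden : ∀ z : ℂ, ‖z‖ ≤ s → v * z - 1 - z * q z ≠ 0 := by
    intro z hz h0
    have hz0 : z ≠ 0 := by rintro rfl; simp at h0
    have : z⁻¹ + q z = v := by
      field_simp
      linear_combination -h0
    have := hinj (x₁ := z) (x₂ := z₁) ⟨by simp; linarith, by simpa using hz0⟩
      ⟨by simpa using h2, by simpa using hz1⟩ this
    rw [this] at hz; linarith
  have hsub : closedBall (0:ℂ) s ⊆ ball 0 1 := closedBall_subset_ball (h1.trans h2)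
  have hd : DiffContOnCl ℂ (fun z => exp (-(v * z / (v * z - 1 - z * q z)))) (ball 0 s) := by
    apply DifferentiableOn.diffContOnCl
    rw [closure_ball _ hs.ne']
    have hq' := hq.mono hsub
    apply DifferentiableOn.cexp
    apply DifferentiableOn.neg
    apply DifferentiableOn.div
    · fun_prop
    · fun_prop
    · intro z hz; exact hden z (by simpa using hz)
  have := norm_le_of_forall_mem_frontier_norm_le (C := Real.exp (-(1/2))) isBounded_ball hd (by
    intro z hz
    rw [frontier_ball _ hs.ne'] at hz
    have hzs : ‖z‖ = s := by simpa using hz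
    have hz0 : z ≠ 0 := by rintro rfl; simp at hzs; linarith
    rw [Complex.norm_exp]
    apply Real.exp_le_exp.mpr
    have hψ := hM z hzs
    set t := (z⁻¹ + q z) / v with ht
    have htn : ‖t‖ < 1 := by
      rw [ht, norm_div, div_lt_one (by positivity)]; linarith
    have he : v * z / (v * z - 1 - z * q z) = (1 - t)⁻¹ := by
      have h1 := hden z hzs.le
      have : 1 - t = (v * z - 1 - z * q z) / (v * z) := by
        rw [ht]; field_simp; ring
      rw [this, inv_div]
    rw [he, neg_re, inv_re, neg_le_neg_iff]
    have hns : normSq t < 1 := by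
      rw [normSq_eq_norm_sq]; nlinarith [norm_nonneg t]
    have hne : 1 - t ≠ 0 := by
      intro h; have : t = 1 := by linear_combination -h
      rw [this] at htn; simp at htn
    rw [le_div_iff₀ (normSq_pos.mpr hne)]
    rw [normSq_apply] at hns ⊢
    simp only [sub_re, one_re, sub_im, one_im]
    nlinarith) (z := 0) (by simp [closure_ball _ hs.ne', hs.le])
  simp at this
  linarith

lemma aux_avg (h : ℂ → ℝ) (ρ : ℝ) (Φ : ℂ → ℂ) (h0 : 0 < ρ) (h1 : ρ < 1)
    (hΦ : DifferentiableOn ℂ Φ (ball 0 1)) (hh : ContinuousOn h (sphere 0 ρ))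
    (hle : ∀ z : ℂ, ‖z‖ = ρ → (Φ z).re ≤ h z) :
    (Φ 0).re ≤ Real.circleAverage h 0 ρ := by
  have hsub : closedBall (0:ℂ) ρ ⊆ ball 0 1 := closedBall_subset_ball h1
  have hd : DiffContOnCl ℂ Φ (ball 0 |ρ|) := by
    rw [abs_of_pos h0]
    apply DifferentiableOn.diffContOnCl
    rw [closure_ball _ h0.ne']
    exact hΦ.mono hsub
  have hci : CircleIntegrable Φ 0 ρ := 
    ContinuousOn.circleIntegrable h0.le ((hΦ.mono hsub).continuousOn.mono sphere_subset_closedBall)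
  have e := reCLM.circleAverage_comp_comm (f := Φ) (c := 0) (R := ρ) hci
  rw [hd.circleAverage] at e
  have : (Φ 0).re = Real.circleAverage (reCLM ∘ Φ) 0 ρ := e.symm
  rw [this]
  apply Real.circleAverage_mono
  · exact ContinuousOn.circleIntegrable h0.le (reCLM.continuous.comp_continuousOn ((hΦ.mono hsub).continuousOn.mono sphere_subset_closedBall))
  · exact hh.circleIntegrable h0.le
  · intro z hz
    apply hle
    simpa [abs_of_pos h0] using hz

lemma aux_inner (q : ℂ → ℂ) (hq : DifferentiableOn ℂ q (ball 0 1)) (ρ : ℝ) (h0 : 0 < ρ) (h1 : ρ < 1) :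
    (ρ^4)⁻¹ + ‖deriv q 0‖^2 ≤ Real.circleAverage (fun z => ‖-(z^2)⁻¹ + deriv q z‖^2) 0 ρ := by
  have hq' : DifferentiableOn ℂ (deriv q) (ball 0 1) := hq.deriv isOpen_ball
  set c := deriv q 0 with hc
  have := aux_avg (fun z => ‖-(z^2)⁻¹ + deriv q z‖^2) ρ 
    (fun z => ((ρ^4)⁻¹ - ‖c‖^2 : ℝ) - 2 * ((ρ^4)⁻¹:ℝ) * z^2 * deriv q z + 2 * (starRingEnd ℂ c) * deriv q z)
    h0 h1 (by fun_prop) (by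
      have : ContinuousOn (deriv q) (sphere 0 ρ) := hq'.continuousOn.mono (sphere_subset_closedBall.trans (closedBall_subset_ball h1))
      have h3 : ContinuousOn (fun z : ℂ => (z^2)⁻¹) (sphere 0 ρ) := by
        apply ContinuousOn.inv₀ (by fun_prop)
        intro z hz
        have : ‖z‖ = ρ := by simpa using hz
        have : z ≠ 0 := by rintro rfl; simp at this; linarith
        positivity
      fun_prop) (by
      intro z hz
      have hz0 : z ≠ 0 := by rintro rfl; simp at hz; linarith
      set w := deriv q z
      have e1 : (z^2)⁻¹ = ((ρ^4)⁻¹:ℝ) * (starRingEnd ℂ) (z^2) := by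
        have : (starRingEnd ℂ) (z^2) * z^2 = ((ρ^4:ℝ):ℂ) := by
          rw [mul_comm, mul_conj, normSq_eq_norm_sq, norm_pow, hz]; norm_cast; ring
        push_cast at this ⊢
        rw [← this]
        have : (starRingEnd ℂ) (z^2) ≠ 0 := by simpa using hz0
        field_simp
      set a := z^2
      have ha : a.re^2 + a.im^2 = ρ^4 := by
        have : normSq a = ρ^4 := by rw [normSq_eq_norm_sq, norm_pow, hz]; ring
        rw [← this, normSq_apply]; ring
      rw [e1, ← normSq_eq_norm_sq, ← normSq_eq_norm_sq, normSq_apply, normSq_apply]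
      set k := (ρ^4)⁻¹
      have hk : k * ρ^4 = 1 := by simp only [k]; field_simp
      rw [← ha] at hk
      simp
      have hk2 : k^2 * (a.re^2+a.im^2) = k := by linear_combination k * hk
      nlinarith [sq_nonneg (w.re - c.re), sq_nonneg (w.im - c.im)])
  refine le_trans (le_of_eq ?_) this
  simp only [← hc]
  generalize (ρ^4)⁻¹ = k
  rw [← normSq_eq_norm_sq, normSq_apply]
  simp
  ring
lemma aux_area (q : ℂ → ℂ) (hq : DifferentiableOn ℂ q (ball 0 1))
    (hinj : InjOn (fun z => z⁻¹ + q z) (ball 0 1 \ {0})) (s r M : ℝ) (hs : 0 < s) (hsr : s < r)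
    (hr : r < 1) (hM : ∀ z : ℂ, ‖z‖ = s → ‖z⁻¹ + q z‖ ≤ M) :
    (s^2)⁻¹ - (r^2)⁻¹ + ‖deriv q 0‖^2 * (r^2 - s^2) ≤ M^2 := by
  have hM0 : 0 ≤ M := (norm_nonneg _).trans (hM s (by simp [abs_of_pos hs]))
  have hq' : DifferentiableOn ℂ (deriv q) (ball 0 1) := hq.deriv isOpen_ball
  set ann : Set ℂ := {z | s < ‖z‖ ∧ ‖z‖ < r} with hann
  have hannm : MeasurableSet ann :=
    ((isOpen_lt continuous_const continuous_norm).inter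
      (isOpen_lt continuous_norm continuous_const)).measurableSet
  set D : ℂ → ℂ := fun z => -(z^2)⁻¹ + deriv q z with hD
  have hderiv : ∀ z ∈ ann, HasDerivAt (fun z => z⁻¹ + q z) (D z) z := by
    intro z hz
    have hz0 : z ≠ 0 := by rintro rfl; simp [hann] at hz; linarith
    have hzb : z ∈ ball (0:ℂ) 1 := by simp; linarith [hz.2]
    exact (hasDerivAt_inv hz0).add (hq.differentiableAt (isOpen_ball.mem_nhds hzb)).hasDerivAt
  have hinj' : InjOn (fun z => z⁻¹ + q z) ann := hinj.mono (by
    intro z hz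
    refine ⟨by simp; linarith [hz.2], ?_⟩
    rintro rfl; simp [hann] at hz; linarith)
  have himg : (fun z => z⁻¹ + q z) '' ann ⊆ closedBall 0 M := by
    rintro _ ⟨z, hz, rfl⟩
    simpa using aux_max q hq hinj s M hs hM z hz.1 (hz.2.trans hr)
  have hvol : volume.real ((fun z => z⁻¹ + q z) '' ann) ≤ Real.pi * M^2 := by
    refine (measureReal_mono himg (by simp [Complex.volume_closedBall]; finiteness)).trans (le_of_eq ?_)
    rw [measureReal_def, Complex.volume_closedBall]
    simp [hM0]; ring
  have hcv : volume.real ((fun z => z⁻¹ + q z) '' ann) = ∫ z in ann, ‖D z‖^2 := by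
    have := integral_image_eq_integral_abs_det_fderiv_smul volume hannm
      (f' := fun z => ((ContinuousLinearMap.toSpanSingleton ℂ (D z)).restrictScalars ℝ))
      (fun z hz => ((hderiv z hz).hasFDerivAt.restrictScalars ℝ).hasFDerivWithinAt) hinj' (fun _ => (1:ℝ))
    simp only [integral_const, measureReal_restrict_apply_univ, smul_eq_mul, mul_one] at this
    rw [this]
    congr 1; ext z
    simp [ContinuousLinearMap.det, LinearMap.det_restrictScalars,
      Algebra.norm_complex_eq, Complex.normSq_eq_norm_sq]
  set P : ℝ × ℝ → ℂ := fun p => p.1 * (Real.cos p.2 + Real.sin p.2 * I) with hP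
  have hPn : ∀ p, ‖P p‖ = |p.1| := fun p => by
    have := Complex.norm_polarCoord_symm p
    rwa [Complex.polarCoord_symm_apply] at this
  have hPc : ∀ ρ θ, P (ρ, θ) = circleMap 0 ρ θ := by
    intro ρ θ
    simp [hP, circleMap, exp_mul_I]
  set F : ℝ × ℝ → ℝ := fun p => p.1 * ‖D (P p)‖^2 with hF
  have hpol : ∫ z in ann, ‖D z‖^2 = ∫ p in Ioo s r ×ˢ Ioo (-Real.pi) Real.pi, F p := by
    rw [← integral_indicator hannm, ← Complex.integral_comp_polarCoord_symm, polarCoord_target]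
    have hsub : Ioo s r ×ˢ Ioo (-Real.pi) Real.pi ⊆ Ioi (0:ℝ) ×ˢ Ioo (-Real.pi) Real.pi := by
      apply Set.prod_mono_left; intro x hx; exact hs.trans hx.1
    rw [setIntegral_eq_of_subset_of_forall_sdiff_eq_zero (measurableSet_Ioi.prod measurableSet_Ioo) hsub (f := fun p => p.1 • ann.indicator (fun z => ‖D z‖^2) (Complex.polarCoord.symm p))]
    · apply setIntegral_congr_fun (measurableSet_Ioo.prod measurableSet_Ioo)
      rintro p ⟨hp1, hp2⟩
      have : P p ∈ ann := by
        simp only [hann, mem_ofPred_eq, hPn, abs_of_pos (hs.trans hp1.1)]; exact hp1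
      simp only [Complex.polarCoord_symm_apply]
      change p.1 • ann.indicator (fun z => ‖D z‖^2) (P p) = _
      rw [indicator_of_mem this]
      simp [hF]
    · rintro p ⟨⟨hp1, hp2⟩, hp3⟩
      have : P p ∉ ann := by
        simp only [hann, mem_ofPred_eq, hPn, abs_of_pos (show 0 < p.1 from hp1)]
        intro h; exact hp3 ⟨h, hp2⟩
      simp only [Complex.polarCoord_symm_apply]
      change p.1 • ann.indicator (fun z => ‖D z‖^2) (P p) = _
      rw [indicator_of_notMem this]
      simp
  have hDc : ContinuousOn D (ball 0 1 \ {0}) := by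
    have h3 : ContinuousOn (fun z : ℂ => (z^2)⁻¹) (ball 0 1 \ {0}) := by
      apply ContinuousOn.inv₀ (by fun_prop)
      intro z hz
      have : z ≠ 0 := hz.2
      positivity
    have := hq'.continuousOn.mono (sdiff_subset : ball (0:ℂ) 1 \ {0} ⊆ _)
    fun_prop
  have hFc : ContinuousOn F (Icc s r ×ˢ Icc (-Real.pi) Real.pi) := by
    have : ContinuousOn (fun p => D (P p)) (Icc s r ×ˢ Icc (-Real.pi) Real.pi) := by
      apply hDc.comp (by fun_prop)
      rintro p ⟨hp1, hp2⟩
      have h1 : ‖P p‖ = p.1 := by rw [hPn, abs_of_pos (hs.trans_le hp1.1)]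
      refine ⟨by simp [h1]; linarith [hp1.2], ?_⟩
      intro h
      rw [mem_singleton_iff] at h
      rw [h, norm_zero] at h1
      linarith [hp1.1]
    exact continuous_fst.continuousOn.mul (this.norm.pow 2)
  have hFi : IntegrableOn F (Ioo s r ×ˢ Ioo (-Real.pi) Real.pi) :=
    (hFc.integrableOn_compact (isCompact_Icc.prod isCompact_Icc)).mono_set
      (prod_mono Ioo_subset_Icc_self Ioo_subset_Icc_self)
  have hFi' : Integrable F ((volume.restrict (Ioo s r)).prod (volume.restrict (Ioo (-Real.pi) Real.pi))) := by
    rw [Measure.prod_restrict]; exact hFi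
  have hfub : ∫ p in Ioo s r ×ˢ Ioo (-Real.pi) Real.pi, F p
      = ∫ ρ in Ioo s r, ∫ θ in Ioo (-Real.pi) Real.pi, F (ρ, θ) :=
    setIntegral_prod _ hFi
  have hinner : ∀ ρ ∈ Ioo s r, 2 * Real.pi * ((ρ^3)⁻¹ + ‖deriv q 0‖^2 * ρ) ≤ ∫ θ in Ioo (-Real.pi) Real.pi, F (ρ, θ) := by
    intro ρ hρ
    have hρ0 : 0 < ρ := hs.trans hρ.1
    have h := aux_inner q hq ρ hρ0 (hρ.2.trans hr)
    have e : ∫ θ in Ioo (-Real.pi) Real.pi, F (ρ, θ) = ρ * (2 * Real.pi * Real.circleAverage (fun z => ‖-(z^2)⁻¹ + deriv q z‖^2) 0 ρ) := by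
      simp only [hF, integral_const_mul]
      congr 1
      rw [Real.circleAverage_eq_integral_add (-Real.pi), smul_eq_mul, mul_inv_cancel_left₀ (by positivity),
        intervalIntegral.integral_comp_add_right
          (fun θ => ‖-(circleMap 0 ρ θ ^ 2)⁻¹ + deriv q (circleMap 0 ρ θ)‖ ^ 2),
        ← integral_Ioc_eq_integral_Ioo,
        ← intervalIntegral.integral_of_le (by linarith [Real.pi_pos])]
      simp only [hPc, hD]
      congr 1 <;> ring
    rw [e]
    calc _ = ρ * (2 * Real.pi * ((ρ^4)⁻¹ + ‖deriv q 0‖^2)) := by field_simp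
      _ ≤ _ := by gcongr
  have houter : ∫ ρ in Ioo s r, 2 * Real.pi * ((ρ^3)⁻¹ + ‖deriv q 0‖^2 * ρ) = Real.pi * ((s^2)⁻¹ - (r^2)⁻¹ + ‖deriv q 0‖^2 * (r^2 - s^2)) := by
    rw [← integral_Ioc_eq_integral_Ioo, ← intervalIntegral.integral_of_le hsr.le]
    have hpos : ∀ x ∈ uIcc s r, x ≠ 0 := by
      intro x hx; rw [uIcc_of_le hsr.le] at hx; exact (hs.trans_le hx.1).ne'
    rw [intervalIntegral.integral_eq_sub_of_hasDerivAt (f := fun x => Real.pi * (-(x^2)⁻¹ + ‖deriv q 0‖^2 * x^2))]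
    · ring
    · intro x hx
      have hx0 := hpos x hx
      have h1 := ((hasDerivAt_pow 2 x).inv (pow_ne_zero 2 hx0)).neg
      have h2 := ((hasDerivAt_pow 2 x).const_mul (‖deriv q 0‖^2))
      refine ((h1.add h2).const_mul Real.pi).congr_deriv ?_
      simp
      field_simp
    · apply ContinuousOn.intervalIntegrable
      apply ContinuousOn.const_mul
      apply ContinuousOn.add _ (by fun_prop)
      apply ContinuousOn.inv₀ (by fun_prop)
      intro x hx; exact pow_ne_zero 3 (hpos x hx)
  have hmono : ∫ ρ in Ioo s r, 2 * Real.pi * ((ρ^3)⁻¹ + ‖deriv q 0‖^2 * ρ) ≤ ∫ ρ in Ioo s r, ∫ θ in Ioo (-Real.pi) Real.pi, F (ρ, θ) := by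
    apply setIntegral_mono_on _ hFi'.integral_prod_left measurableSet_Ioo hinner
    apply IntegrableOn.mono_set (t := Icc s r) _ Ioo_subset_Icc_self
    apply ContinuousOn.integrableOn_compact isCompact_Icc
    apply ContinuousOn.const_mul
    apply ContinuousOn.add _ (by fun_prop)
    apply ContinuousOn.inv₀ (by fun_prop)
    intro x hx; exact pow_ne_zero 3 (hs.trans_le hx.1).ne'
  rw [houter, ← hfub, ← hpol, ← hcv] at hmono
  exact le_of_mul_le_mul_left (hmono.trans hvol) Real.pi_pos
lemma aux_coeff (q : ℂ → ℂ) (hq : DifferentiableOn ℂ q (ball 0 1)) (hq0 : q 0 = 0)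
    (hinj : InjOn (fun z => z⁻¹ + q z) (ball 0 1 \ {0})) : ‖deriv q 0‖ ≤ 6 := by
  by_contra! hc
  set c := ‖deriv q 0‖ with hcdef
  have hd : HasDerivAt q (deriv q 0) 0 :=
    (hq.differentiableAt (isOpen_ball.mem_nhds (by simp))).hasDerivAt
  have hev := (hasDerivAt_iff_isLittleO.mp hd).def (c := 1) one_pos
  obtain ⟨δ, hδ, hδ'⟩ := Metric.eventually_nhds_iff.mp hev
  set s := min (δ/2) (1/10) with hs
  have hs0 : 0 < s := by positivity
  have hsd : s < δ := (min_le_left _ _).trans_lt (by linarith)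
  have hs1 : s ≤ 1/10 := min_le_right _ _
  have := aux_area q hq hinj s (4/5) (s⁻¹ + (c+1)*s) hs0 (by linarith) (by norm_num) (by
    intro z hz
    have h := hδ' (y := z) (by simpa [hz] using hsd)
    simp only [hq0, sub_zero, smul_eq_mul, one_mul] at h
    have h2 : ‖q z‖ ≤ (c+1)*s := by
      calc ‖q z‖ = ‖(q z - z * deriv q 0) + z * deriv q 0‖ := by ring_nf
        _ ≤ ‖q z - z * deriv q 0‖ + ‖z * deriv q 0‖ := norm_add_le _ _
        _ ≤ ‖z‖ + ‖z‖ * c := by rw [norm_mul]; gcongr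
        _ = _ := by rw [hz]; ring
    calc _ ≤ ‖z⁻¹‖ + ‖q z‖ := norm_add_le _ _
      _ ≤ _ := by rw [norm_inv, hz]; gcongr)
  have e : (s⁻¹ + (c+1)*s)^2 = (s^2)⁻¹ + 2*(c+1) + (c+1)^2*s^2 := by field_simp; ring
  rw [e] at this
  have hss : s^2 ≤ 1/100 := by nlinarith
  have h1 : c^2 * s^2 ≤ c^2*(1/100) := by gcongr
  have h2 : (c+1)^2 * s^2 ≤ (c+1)^2*(1/100) := by gcongr
  norm_num at this
  nlinarith

lemma aux_bieb (f : ℂ → ℂ) (hf : DifferentiableOn ℂ f (ball 0 1)) (hinj : InjOn f (ball 0 1))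
    (hf0 : f 0 = 0) (hf1 : deriv f 0 = 1) : ‖deriv (deriv f) 0‖ ≤ 24 := by
  have h0b : (0:ℂ) ∈ ball (0:ℂ) 1 := by simp
  have hnb : ball (0:ℂ) 1 ∈ 𝓝 0 := isOpen_ball.mem_nhds h0b
  set d := dslope f 0 with hd
  have hdd : DifferentiableOn ℂ d (ball 0 1) := (differentiableOn_dslope hnb).mpr hf
  have hfd : ∀ z, f z = z * d z := by
    intro z
    have := sub_smul_dslope f 0 z
    simp [hf0] at this
    rw [hd, this]
  have hd0 : d 0 = 1 := by rw [hd, dslope_same, hf1]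
  have hdne : ∀ z ∈ ball (0:ℂ) 1, d z ≠ 0 := by
    intro z hz h
    have h1 : f z = f 0 := by rw [hfd z, h, hf0, mul_zero]
    have := hinj hz h0b h1
    rw [this, hd0] at h
    exact one_ne_zero h
  have hd' : DifferentiableOn ℂ (deriv d) (ball 0 1) := hdd.deriv isOpen_ball
  obtain ⟨L, hL0, hL⟩ := ((hd'.div hdd hdne).isExactOn_ball).with_val_at 0 0
  have hexp : ∀ z ∈ ball (0:ℂ) 1, d z * exp (-L z) = 1 := by
    have hder : ∀ z ∈ ball (0:ℂ) 1, HasDerivAt (fun z => d z * exp (-L z)) 0 z := by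
      intro z hz
      have h1 := (hdd.differentiableAt (isOpen_ball.mem_nhds hz)).hasDerivAt
      have h2 := (hL z hz).neg.cexp
      refine (h1.mul h2).congr_deriv ?_
      have := hdne z hz
      simp
      field_simp
      ring
    intro z hz
    have := isOpen_ball.is_const_of_deriv_eq_zero (convex_ball (0:ℂ) 1).isPreconnected
      (fun z hz => (hder z hz).differentiableAt.differentiableWithinAt)
      (fun z hz => (hder z hz).deriv) hz h0b
    rw [this, hd0, hL0]; simp
  set j : ℂ → ℂ := fun z => exp (-L z / 2) with hj
  have hjd : ∀ z ∈ ball (0:ℂ) 1, HasDerivAt j (exp (-L z / 2) * (-(deriv d z / d z) / 2)) z :=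
    fun z hz => ((hL z hz).neg.div_const 2).cexp
  have hjD : DifferentiableOn ℂ j (ball 0 1) := fun z hz => (hjd z hz).differentiableAt.differentiableWithinAt
  have hj2 : ∀ z ∈ ball (0:ℂ) 1, d z * (j z)^2 = 1 := by
    intro z hz
    rw [← hexp z hz, hj]
    simp only
    rw [← Complex.exp_nat_mul]; congr 2; push_cast; ring
  set p := dslope j 0 with hp
  have hpD : DifferentiableOn ℂ p (ball 0 1) := (differentiableOn_dslope hnb).mpr hjD
  have hj0 : j 0 = 1 := by simp [hj, hL0]
  have hjp : ∀ z, j z = 1 + z * p z := by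
    intro z
    have := sub_smul_dslope j 0 z
    simp [hj0] at this
    rw [hp, this]; ring
  have hp0 : p 0 = - deriv d 0 / 2 := by
    rw [hp, dslope_same, (hjd 0 h0b).deriv, hL0, hd0]; simp
  have hsq : ∀ z ∈ ball (0:ℂ) 1, z^2 ∈ ball (0:ℂ) 1 := by
    intro z hz
    simp at hz ⊢
    nlinarith [norm_nonneg z]
  have hq : DifferentiableOn ℂ (fun z => z * p (z^2)) (ball 0 1) := by
    apply DifferentiableOn.mul (by fun_prop)
    exact hpD.comp (by fun_prop) hsq
  have hq1 : deriv (fun z => z * p (z^2)) 0 = p 0 := by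
    have h1 : DifferentiableAt ℂ (fun z : ℂ => p (z^2)) 0 :=
      (hpD.comp (g := p) (f := fun z : ℂ => z^2) (by fun_prop) hsq).differentiableAt hnb
    have := (hasDerivAt_id (0:ℂ)).mul h1.hasDerivAt
    have h2 := this.deriv
    simp at h2
    exact h2
  have key : ∀ z ∈ ball (0:ℂ) 1 \ {0}, z⁻¹ + z * p (z^2) = j (z^2) / z := by
    intro z hz
    have hz0 : z ≠ 0 := hz.2
    rw [hjp]; field_simp
  have hcoef := aux_coeff (fun z => z * p (z^2)) hq (by simp) (by
    intro z hz w hw h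
    simp only at h
    rw [key z hz, key w hw] at h
    have hz0 : z ≠ 0 := hz.2
    have hw0 : w ≠ 0 := hw.2
    have e1 := hj2 _ (hsq z hz.1)
    have e2 := hj2 _ (hsq w hw.1)
    have hjz : j (z^2) ≠ 0 := exp_ne_zero _
    have h3 : f (z^2) = f (w^2) := by
      rw [hfd, hfd]
      have a1 : d (z^2) = ((j (z^2))^2)⁻¹ := eq_inv_of_mul_eq_one_left e1
      have a2 : d (w^2) = ((j (w^2))^2)⁻¹ := eq_inv_of_mul_eq_one_left e2
      have : z^2 * ((j (z^2))^2)⁻¹ = ((j (z^2) / z)^2)⁻¹ := by field_simp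
      rw [a1, a2, this, h]
      field_simp
    have h4 := hinj (hsq z hz.1) (hsq w hw.1) h3
    rw [h4] at h hjz
    field_simp at h
    exact h.symm)
  rw [hq1, hp0] at hcoef
  have hfdd : deriv (deriv f) 0 = 2 * deriv d 0 := by
    have : deriv f =ᶠ[𝓝 0] fun z => d z + z * deriv d z := by
      filter_upwards [hnb] with z hz
      have h1 := (hasDerivAt_id z).mul (hdd.differentiableAt (isOpen_ball.mem_nhds hz)).hasDerivAt
      have : f = id * d := by ext z; simp [hfd z]
      rw [this, h1.deriv]; simp
    rw [this.deriv_eq]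
    have h1 := (hdd.differentiableAt hnb).hasDerivAt
    have h2 := (hasDerivAt_id (0:ℂ)).mul (hd'.differentiableAt hnb).hasDerivAt
    have := (h1.add h2).deriv
    have e : (d + id * deriv d) = fun z => d z + z * deriv d z := by ext z; simp
    rw [e] at this
    rw [this]; simp; ring
  rw [hfdd]
  simp at hcoef ⊢
  linarith

lemma aux_dist0 (f : ℂ → ℂ) (z₀ : ℂ) (r : ℝ) (hr : 0 < r) (hf : DifferentiableOn ℂ f (ball z₀ r))
    (hinj : InjOn f (ball z₀ r)) (hne : deriv f z₀ ≠ 0) :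
    ‖deriv (deriv f) z₀‖ ≤ 24 / r * ‖deriv f z₀‖ := by
  have hrc : (r:ℂ) ≠ 0 := by exact_mod_cast hr.ne'
  set F : ℂ → ℂ := fun w => (f (z₀ + r * w) - f z₀) / (r * deriv f z₀) with hF
  have hmap : ∀ w ∈ ball (0:ℂ) 1, z₀ + r * w ∈ ball z₀ r := by
    intro w hw
    simp at hw ⊢
    rw [abs_of_pos hr]; nlinarith
  have hd1 : ∀ w, deriv F w = deriv f (z₀ + r * w) / deriv f z₀ := by
    intro w
    rw [hF]
    simp only [deriv_div_const, deriv_sub_const]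
    rw [deriv_comp_mul_left (r:ℂ) (fun w => f (z₀ + w)), deriv_comp_const_add]
    simp; field_simp
  have hd2 : deriv (deriv F) 0 = r * deriv (deriv f) z₀ / deriv f z₀ := by
    rw [funext hd1]
    simp only [deriv_div_const]
    rw [deriv_comp_mul_left (r:ℂ) (fun w => deriv f (z₀ + w)), deriv_comp_const_add]
    simp
  have := aux_bieb F (by
      apply DifferentiableOn.div_const
      apply DifferentiableOn.sub_const
      exact hf.comp (by fun_prop) hmap) (by
      intro a ha b hb h
      simp only [hF] at h
      rw [div_left_inj' (by positivity), sub_left_inj] at h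
      have := hinj (hmap a ha) (hmap b hb) h
      simpa [hrc] using this) (by simp [hF]) (by rw [hd1]; simp [hne])
  rw [hd2, norm_div, norm_mul] at this
  simp only [norm_real, Real.norm_eq_abs, abs_of_pos hr] at this
  rw [div_le_iff₀ (by positivity)] at this
  rw [div_mul_eq_mul_div, le_div_iff₀ hr]; linarith

lemma aux_dist (f : ℂ → ℂ) (z₀ : ℂ) (r : ℝ) (hr : 0 < r) (hf : DifferentiableOn ℂ f (ball z₀ r))
    (hinj : InjOn f (ball z₀ r)) :
    ‖deriv (deriv f) z₀‖ ≤ 48 / r * ‖deriv f z₀‖ := by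
  have hz : z₀ ∈ ball z₀ r := by simp [hr]
  have h1 : AnalyticAt ℂ (deriv f) z₀ := (hf.analyticAt (isOpen_ball.mem_nhds hz)).deriv
  rcases h1.eventually_eq_zero_or_eventually_ne_zero with h | h
  · have : deriv f =ᶠ[𝓝 z₀] fun _ => 0 := h
    rw [this.deriv_eq]; simp; positivity
  · have h2 : Tendsto (fun z => ‖deriv (deriv f) z‖) (𝓝[≠] z₀) (𝓝 ‖deriv (deriv f) z₀‖) :=
      h1.deriv.continuousAt.norm.tendsto.mono_left nhdsWithin_le_nhds
    have h3 : Tendsto (fun z => 48 / r * ‖deriv f z‖) (𝓝[≠] z₀) (𝓝 (48 / r * ‖deriv f z₀‖)) :=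
      (h1.continuousAt.norm.tendsto.const_mul _).mono_left nhdsWithin_le_nhds
    refine le_of_tendsto_of_tendsto h2 h3 ?_
    have hb : ∀ᶠ z in 𝓝[≠] z₀, z ∈ ball z₀ (r/2) :=
      nhdsWithin_le_nhds (ball_mem_nhds _ (by positivity))
    filter_upwards [h, hb] with z hz1 hz2
    have hsub : ball z (r/2) ⊆ ball z₀ r := by
      apply ball_subset_ball'
      rw [mem_ball] at hz2; linarith
    have := aux_dist0 f z (r/2) (by positivity) (hf.mono hsub) (hinj.mono hsub) hz1
    have e : 24 / (r/2) = 48 / r := by field_simp; norm_num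
    rwa [e] at this
lemma aux_real_deriv (g : ℝ → ℝ) (G : ℂ → ℂ) (hG : ∀ x : ℝ, DifferentiableAt ℂ G x)
    (hGreal : ∀ x : ℝ, G x = ((g x : ℝ) : ℂ)) (x : ℝ) : deriv G x = ((deriv g x : ℝ) : ℂ) := by
  have h1 : HasDerivAt (fun y : ℝ => G y) (deriv G x) x := (hG x).hasDerivAt.comp_ofReal
  have h2 : HasDerivAt g (deriv G x).re x := by
    have := (hG x).hasDerivAt.real_of_complex
    simpa [hGreal] using this
  have h3 := h2.ofReal_comp
  have h4 : (fun y : ℝ => G y) = fun y => ((g y : ℝ) : ℂ) := funext hGreal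
  rw [h4] at h1
  rw [h2.deriv]
  exact h1.unique h3

lemma aux_strip_bound (Δ : ℝ) (G : ℂ → ℂ) (hG : DifferentiableOn ℂ G {z : ℂ | |z.im| < Δ})
    (hinj : InjOn G {z : ℂ | |z.im| < Δ}) (R : ℝ) (hR : R < Δ) (z : ℂ) (hz : |z.im| ≤ R) :
    ‖deriv (deriv G) z‖ ≤ 48 / (Δ - R) * ‖deriv G z‖ := by
  have hsub : ball z (Δ - R) ⊆ {z : ℂ | |z.im| < Δ} := by
    intro w hw
    have h1 : |(w - z).im| < Δ - R := (abs_im_le_norm _).trans_lt (by simpa [dist_eq_norm] using hw)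
    have h2 : |w.im| ≤ |(w-z).im| + |z.im| := by
      have := abs_add_le (w-z).im z.im
      simpa using this
    change |w.im| < Δ
    linarith
  exact aux_dist G z (Δ - R) (by linarith) (hG.mono hsub) (hinj.mono hsub)

lemma aux_gron (Δ : ℝ) (G : ℂ → ℂ) (hG : DifferentiableOn ℂ G {z : ℂ | |z.im| < Δ})
    (hinj : InjOn G {z : ℂ | |z.im| < Δ}) (R D : ℝ) (hR0 : 0 < R) (hR : R < Δ) (hD : 0 < D)
    (x₀ : ℝ) (hx₀ : deriv G x₀ = 1)
    (z : ℂ) (hz : |z.im| ≤ R) (hzD : ‖z - x₀‖ ≤ D) :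
    ‖deriv G z - 1‖ ≤ Real.exp (48 / (Δ - R) * D) - 1 := by
  have hopen : IsOpen {z : ℂ | |z.im| < Δ} := isOpen_lt (by fun_prop) continuous_const
  have hG' : DifferentiableOn ℂ (deriv G) {z : ℂ | |z.im| < Δ} := hG.deriv hopen
  set e := 48 / (Δ - R) with he
  have he0 : 0 < e := div_pos (by norm_num) (by linarith)
  have hseg : ∀ t ∈ Icc (0:ℝ) 1, |((x₀:ℂ) + t * (z - x₀)).im| ≤ R := by
    intro t ht
    simp [abs_mul, abs_of_nonneg ht.1]
    nlinarith [ht.1, ht.2, abs_nonneg z.im]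
  have hder : ∀ t ∈ Icc (0:ℝ) 1, HasDerivAt (fun t : ℝ => deriv G ((x₀:ℂ) + t * (z - x₀)) - 1)
      (deriv (deriv G) ((x₀:ℂ) + t * (z - x₀)) * (z - x₀)) t := by
    intro t ht
    have h1 := (hG'.differentiableAt (hopen.mem_nhds
      (show |((x₀:ℂ) + t * (z - x₀)).im| < Δ from (hseg t ht).trans_lt hR))).hasDerivAt
    have h2 : HasDerivAt (fun s : ℂ => (x₀:ℂ) + s * (z - x₀)) (z - x₀) (t:ℂ) := by
      simpa using ((hasDerivAt_id (t:ℂ)).mul_const (z - x₀)).const_add (x₀:ℂ)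
    exact ((h1.comp (t:ℂ) h2).comp_ofReal).sub_const 1
  have := norm_le_gronwallBound_of_norm_deriv_right_le (δ := 0) (K := e * D) (ε := e * D) (a := 0) (b := 1)
    (f := fun t : ℝ => deriv G ((x₀:ℂ) + t * (z - x₀)) - 1)
    (fun t ht => (hder t ht).continuousAt.continuousWithinAt)
    (fun t ht => (hder t (Ico_subset_Icc_self ht)).hasDerivWithinAt) (by simp [hx₀]) (by
      intro t ht
      have h1 := aux_strip_bound Δ G hG hinj R hR _ (hseg t (Ico_subset_Icc_self ht))
      rw [norm_mul]
      set a := deriv G ((x₀:ℂ) + t * (z - x₀))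
      have h2 : ‖a‖ ≤ ‖a - 1‖ + 1 := by
        have := norm_add_le (a - 1) 1
        simpa using this
      calc _ ≤ (e * ‖a‖) * D := by gcongr
        _ ≤ (e * (‖a - 1‖ + 1)) * D := by gcongr
        _ = _ := by ring) 1 (by simp)
  rw [gronwallBound_of_K_ne_0 (by positivity)] at this
  have hne : e * D ≠ 0 := by positivity
  simpa [div_self hne] using this

lemma aux_close (α : ℝ) (Δ : ℝ) (g : ℝ → ℝ) (G : ℂ → ℂ)
    (hG : DifferentiableOn ℂ G {z : ℂ | |z.im| < Δ})
    (hinj : InjOn G {z : ℂ | |z.im| < Δ})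
    (hGreal : ∀ x : ℝ, G (x : ℂ) = ((g x : ℝ) : ℂ))
    (hganal : ∀ x : ℝ, AnalyticAt ℝ g x)
    (hgper : ∀ x : ℝ, g (x + 1) = g x + 1)
    (hrot : ∀ x : ℝ, Tendsto (fun m : ℕ => (g^[m] x - x) / m) atTop (𝓝 α))
    (R : ℝ) (hR0 : 0 < R) (hR : R < Δ) (z : ℂ) (hz : |z.im| ≤ R) (hzr : |z.re| ≤ 1/2) :
    ‖G z - z - α‖ ≤ 2 * ((Real.exp (48 / (Δ - R) * (R+2)) - 1) * (R+2)) := by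
  have hopen : IsOpen {z : ℂ | |z.im| < Δ} := isOpen_lt (by fun_prop) continuous_const
  have hgd : Differentiable ℝ g := fun x => (hganal x).differentiableAt
  obtain ⟨x₀, hx₀, hx₀d⟩ := exists_deriv_eq_slope g (zero_lt_one) hgd.continuous.continuousOn hgd.differentiableOn
  have h01 := hgper 0
  rw [zero_add] at h01
  rw [h01] at hx₀d
  simp at hx₀d
  have hGx : ∀ x : ℝ, DifferentiableAt ℂ G x := fun x =>
    hG.differentiableAt (hopen.mem_nhds (show |(x:ℂ).im| < Δ by simp; linarith))
  have hGx₀ : deriv G x₀ = 1 := by rw [aux_real_deriv g G hGx hGreal, hx₀d]; simp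
  set B := (Real.exp (48 / (Δ - R) * (R+2)) - 1) with hB
  set c := g x₀ - x₀ with hc
  have hmain : ∀ z : ℂ, |z.im| ≤ R → |z.re| ≤ 1/2 → ‖G z - z - c‖ ≤ B * (R+2) := by
    intro z hz hzr
    set s : Set ℂ := {w | |w.im| ≤ R} ∩ closedBall (x₀:ℂ) (R+2) with hs
    have hconv : Convex ℝ s := by
      apply Convex.inter _ (convex_closedBall _ _)
      have : {w : ℂ | |w.im| ≤ R} = imCLM ⁻¹' (Icc (-R) R) := by
        ext w; simp [abs_le]
      rw [this]
      exact (convex_Icc _ _).linear_preimage imCLM.toLinearMap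
    have hzD : ‖z - x₀‖ ≤ R + 2 := by
      have := norm_le_abs_re_add_abs_im (z - x₀)
      simp at this
      have h2 : |z.re - x₀| ≤ 2 := by
        rw [abs_le] at hzr ⊢
        constructor <;> linarith [hx₀.1, hx₀.2, hzr.1, hzr.2]
      linarith
    have := hconv.norm_image_sub_le_of_norm_hasDerivWithin_le (f := fun w => G w - w)
      (f' := fun w => deriv G w - 1) (C := B) (x := x₀) (y := z) (by
        intro w hw
        have h1 := (hG.differentiableAt (hopen.mem_nhds
          (show |w.im| < Δ from hw.1.trans_lt hR))).hasDerivAt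
        exact (h1.sub (hasDerivAt_id w)).hasDerivWithinAt) (by
        intro w hw
        exact aux_gron Δ G hG hinj R (R+2) hR0 hR (by linarith) x₀ hGx₀ w hw.1
          (by simpa [dist_eq_norm] using hw.2))
      ⟨by simp [hR0.le], by simp; linarith⟩ ⟨hz, by simpa [dist_eq_norm] using hzD⟩
    have hB0 : 0 ≤ B := by
      rw [hB, sub_nonneg]
      apply Real.one_le_exp
      have : 0 < Δ - R := by linarith
      positivity
    calc ‖G z - z - c‖ = ‖G z - z - (G x₀ - x₀)‖ := by rw [hGreal, hc]; push_cast; rfl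
      _ ≤ B * ‖z - x₀‖ := this
      _ ≤ _ := by gcongr
  set E := B * (R+2) with hE
  have hreal1 : ∀ x : ℝ, |x| ≤ 1/2 → |g x - x - c| ≤ E := by
    intro x hx
    have := hmain x (by simp [hR0.le]) (by simpa using hx)
    rw [hGreal] at this
    rw [← Real.norm_eq_abs, ← norm_real]
    exact_mod_cast this
  have hper : Function.Periodic (fun x => g x - x - c) 1 := by
    intro x
    simp only [hgper]; ring
  have hreal : ∀ x : ℝ, |g x - x - c| ≤ E := by
    intro x
    have h1 := hper.sub_int_mul_eq (x := x) (round x)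
    rw [← h1]
    apply hreal1
    rw [mul_one]
    exact abs_sub_round x
  have hit : ∀ m : ℕ, ∀ x : ℝ, |g^[m] x - x - m * c| ≤ m * E := by
    intro m
    induction m with
    | zero => intro x; simp
    | succ k ih =>
      intro x
      rw [Function.iterate_succ_apply']
      have h1 := ih x
      have h2 := hreal (g^[k] x)
      have e : g (g^[k] x) - x - ((k+1 : ℕ):ℝ) * c = (g (g^[k] x) - g^[k] x - c) + (g^[k] x - x - k * c) := by
        push_cast; ring
      rw [e]
      refine (abs_add_le _ _).trans ?_
      push_cast; linarith
  have hαc : |α - c| ≤ E := by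
    have ht := ((hrot 0).sub_const c).abs
    refine le_of_tendsto ht ?_
    filter_upwards [eventually_gt_atTop 0] with m hm
    have hm' : (0:ℝ) < m := by exact_mod_cast hm
    have e : (g^[m] 0 - 0) / (m:ℝ) - c = (g^[m] 0 - 0 - m * c) / m := by field_simp
    rw [e, abs_div, abs_of_pos hm', div_le_iff₀ hm']
    linarith [hit m 0]
  have h3 := hmain z hz hzr
  have h4 : ‖((c - α : ℝ) : ℂ)‖ ≤ E := by
    rw [norm_real, Real.norm_eq_abs, abs_sub_comm]; exact hαc
  have e : G z - z - α = (G z - z - c) + ((c - α : ℝ) : ℂ) := by push_cast; ring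
  rw [e]
  refine (norm_add_le _ _).trans ?_
  linarith

/-- **Large strips force the dynamics to be close to the rigid rotation.**
Let `Δ_k → +∞` and for each `k` let `g_k ∈ D^ω(𝕋, Δ_k)` (with holomorphic extension `G_k`
to the strip `B_{Δ_k}`) have rotation number `α`, `α` irrational.  Let `A_k` be the induced
map on the annulus `A_{Δ_k} = E(B_{Δ_k})`, `E(z) = e^{2πiz}`, so `A_k(e^{2πiz}) = e^{2πi g_k(z)}`.
Then (1) `A_k` converges to the rotation `w ↦ e^{2πiα} w` uniformly on compact subsets of
`ℂ ∖ {0}`, and (2) the nonlinearity `sup_x |g_k″(x)/g_k′(x)|` tends to `0`. -/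
theorem large_strip_implies_close_to_rotation
    (α : ℝ) (hα : Irrational α)
    (Δ : ℕ → ℝ) (hΔpos : ∀ k, 0 < Δ k) (hΔtop : Tendsto Δ atTop atTop)
    (g : ℕ → ℝ → ℝ) (G : ℕ → ℂ → ℂ) (V : ℕ → Set ℂ)
    (hVopen : ∀ k, IsOpen (V k))
    (hVΔ : ∀ k, closure {z : ℂ | |z.im| < Δ k} ⊆ V k)
    (hVshift : ∀ k, ∀ z : ℂ, z ∈ V k ↔ z + 1 ∈ V k)
    (hGholo : ∀ k, DifferentiableOn ℂ (G k) (V k))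
    (hGinj : ∀ k, Set.InjOn (G k) (V k))
    (hGonto : ∀ k, closure {z : ℂ | |z.im| < Δ k} ⊆ G k '' V k)
    (hGreal : ∀ k, ∀ x : ℝ, G k (x : ℂ) = ((g k x : ℝ) : ℂ))
    (hganal : ∀ k, ∀ x : ℝ, AnalyticAt ℝ (g k) x)
    (hgmono : ∀ k, StrictMono (g k)) (hgsurj : ∀ k, Function.Surjective (g k))
    (hgper : ∀ k, ∀ x : ℝ, g k (x + 1) = g k x + 1)
    (hGper : ∀ k, ∀ z ∈ V k, G k (z + 1) = G k z + 1)
    (hrot : ∀ k, ∀ x : ℝ,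
      Tendsto (fun m : ℕ => ((g k)^[m] x - x) / m) atTop (𝓝 α))
    (A : ℕ → ℂ → ℂ)
    (hA : ∀ k, ∀ z : ℂ, |z.im| < Δ k →
      A k (Complex.exp (2 * Real.pi * Complex.I * z)) =
        Complex.exp (2 * Real.pi * Complex.I * G k z)) :
    (∀ S : Set ℂ, IsCompact S → (0 : ℂ) ∉ S →
      ∀ ε > (0 : ℝ), ∃ K : ℕ, ∀ k ≥ K,
        (S ⊆ (fun z => Complex.exp (2 * Real.pi * Complex.I * z)) ''
          {z : ℂ | |z.im| < Δ k}) ∧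
        ∀ w ∈ S, ‖A k w - Complex.exp (2 * Real.pi * Complex.I * α) * w‖ ≤ ε) ∧
    (∀ ε > (0 : ℝ), ∃ K : ℕ, ∀ k ≥ K, ∀ x : ℝ,
      |iteratedDeriv 2 (g k) x / deriv (g k) x| ≤ ε) := by
  have hsubV : ∀ k, {z : ℂ | |z.im| < Δ k} ⊆ V k := fun k => subset_closure.trans (hVΔ k)
  have hGd : ∀ k, DifferentiableOn ℂ (G k) {z : ℂ | |z.im| < Δ k} := fun k => (hGholo k).mono (hsubV k)
  have hGi : ∀ k, InjOn (G k) {z : ℂ | |z.im| < Δ k} := fun k => (hGinj k).mono (hsubV k)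
  constructor
  · intro S hS h0S ε hε
    obtain ⟨M, hM⟩ := hS.exists_bound_of_continuousOn (f := fun w : ℂ => w) continuousOn_id
    obtain ⟨Q, hQ⟩ := hS.exists_bound_of_continuousOn (f := fun w : ℂ => Real.log ‖w‖) (by
      intro w hw
      have : w ≠ 0 := by rintro rfl; exact h0S hw
      exact (continuous_norm.continuousAt.log (by simpa using this)).continuousWithinAt)
    set R := |Q| + 1 with hR
    have hR0 : 0 < R := by positivity
    have hexp : Tendsto (fun u : ℂ => (|M| + 1) * ‖exp (2 * Real.pi * I * u) - 1‖) (𝓝 0) (𝓝 0) := by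
      have : Continuous (fun u : ℂ => (|M| + 1) * ‖exp (2 * Real.pi * I * u) - 1‖) := by fun_prop
      simpa using this.tendsto 0
    obtain ⟨δ, hδ, hδ'⟩ := Metric.eventually_nhds_iff.mp (hexp.eventually (gt_mem_nhds hε))
    have hB : Tendsto (fun k => 2 * ((Real.exp (48 / (Δ k - R) * (R+2)) - 1) * (R+2))) atTop (𝓝 0) := by
      have h1 : Tendsto (fun k => 48 / (Δ k - R)) atTop (𝓝 0) :=
        (tendsto_atTop_add_const_right atTop (-R) hΔtop).const_div_atTop 48
      have h2 : Continuous (fun u : ℝ => 2 * ((Real.exp (u * (R+2)) - 1) * (R+2))) := by fun_prop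
      simpa [Function.comp_def] using (h2.tendsto 0).comp h1
    obtain ⟨K, hK⟩ := eventually_atTop.mp
      ((hB.eventually (gt_mem_nhds hδ)).and (hΔtop.eventually_gt_atTop R))
    refine ⟨K, fun k hk => ?_⟩
    obtain ⟨hk1, hk2⟩ := hK k hk
    have hpi := Real.pi_pos
    have hz : ∀ w ∈ S, ∃ z : ℂ, exp (2 * Real.pi * I * z) = w ∧ |z.im| ≤ R ∧ |z.re| ≤ 1/2 := by
      intro w hw
      have hw0 : w ≠ 0 := by rintro rfl; exact h0S hw
      refine ⟨⟨arg w / (2 * Real.pi), - Real.log ‖w‖ / (2 * Real.pi)⟩, ?_, ?_, ?_⟩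
      · have : 2 * (Real.pi : ℂ) * I * (⟨arg w / (2 * Real.pi), - Real.log ‖w‖ / (2 * Real.pi)⟩ : ℂ) = log w := by
          apply Complex.ext
          · simp [log_re]; field_simp
          · simp [log_im]; field_simp
        rw [this, exp_log hw0]
      · have h1 := hQ w hw
        rw [Real.norm_eq_abs] at h1
        simp only [abs_div, abs_neg]
        rw [abs_of_pos (show 0 < 2 * Real.pi by positivity), div_le_iff₀ (by positivity)]
        have h2 : (1:ℝ) ≤ 2 * Real.pi := by linarith [Real.pi_gt_three]
        nlinarith [le_abs_self Q, abs_nonneg Q]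
      · simp only [abs_div]
        rw [abs_of_pos (show 0 < 2 * Real.pi by positivity), div_le_iff₀ (by positivity)]
        linarith [abs_arg_le_pi w]
    constructor
    · intro w hw
      obtain ⟨z, h1, h2, h3⟩ := hz w hw
      exact ⟨z, h2.trans_lt hk2, h1⟩
    · intro w hw
      obtain ⟨z, h1, h2, h3⟩ := hz w hw
      have hcl := aux_close α (Δ k) (g k) (G k) (hGd k) (hGi k) (hGreal k) (hganal k) (hgper k)
        (hrot k) R hR0 hk2 z h2 h3
      have hu := hδ' (y := G k z - z - α) (by rw [dist_zero_right]; linarith)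
      rw [← h1, hA k z (h2.trans_lt hk2)]
      have e : exp (2 * Real.pi * I * G k z) - exp (2 * Real.pi * I * α) * exp (2 * Real.pi * I * z)
          = (exp (2 * Real.pi * I * α) * exp (2 * Real.pi * I * z)) * (exp (2 * Real.pi * I * (G k z - z - α)) - 1) := by
        rw [mul_sub, mul_one, ← Complex.exp_add, ← Complex.exp_add]
        congr 2; ring
      rw [e, norm_mul, norm_mul, h1]
      have h5 : ‖exp (2 * Real.pi * I * (α:ℂ))‖ = 1 := by
        rw [Complex.norm_exp]; simp
      rw [h5, one_mul]
      have h6 : ‖w‖ ≤ |M| + 1 := by linarith [hM w hw, le_abs_self M]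
      refine le_trans ?_ hu.le
      gcongr
  · intro ε hε
    have h1 : Tendsto (fun k => 48 / (Δ k - 0)) atTop (𝓝 0) := by
      simpa using hΔtop.const_div_atTop 48
    obtain ⟨K, hK⟩ := eventually_atTop.mp (h1.eventually (gt_mem_nhds hε))
    refine ⟨K, fun k hk x => ?_⟩
    have hopen : IsOpen {z : ℂ | |z.im| < Δ k} := isOpen_lt (by fun_prop) continuous_const
    have hmem : ∀ x : ℝ, {z : ℂ | |z.im| < Δ k} ∈ 𝓝 (x:ℂ) := fun x =>
      hopen.mem_nhds (show |(x:ℂ).im| < Δ k by simpa using hΔpos k)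
    have e1 := aux_real_deriv (g k) (G k) (fun x => (hGd k).differentiableAt (hmem x)) (hGreal k)
    have e2 := aux_real_deriv (deriv (g k)) (deriv (G k))
      (fun x => ((hGd k).deriv hopen).differentiableAt (hmem x)) e1
    have hb := aux_strip_bound (Δ k) (G k) (hGd k) (hGi k) 0 (hΔpos k) x (by simp)
    rw [e1, e2, norm_real, norm_real, Real.norm_eq_abs, Real.norm_eq_abs] at hb
    rw [iteratedDeriv_succ, iteratedDeriv_one, abs_div]
    apply div_le_of_le_mul₀ (abs_nonneg _) hε.le
    refine hb.trans ?_
    gcongr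
    exact (hK k hk).le
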